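/- Let 0 ≤ m ≤ n. Every nonzero H-submodule of S_m contains v(a₁,…,a_m) for some m-element subset {a₁ < ⋯ < a_m} of {1,…,n}. -/

import Mathlib

namespace KLRHook

/-- Generators of the cyclotomic Khovanov--Lauda--Rouquier algebra in level two:
idempotents `E i` for residue sequences `i`, dots `Y r` (1-indexed, `1 ≤ r ≤ n`)
and crossings `Psi r` (1-indexed, `1 ≤ r ≤ n - 1`). -/
inductive Gen (e n : ℕ) : Type
  | E : (Fin n → ZMod e) → Gen e n
  | Y : ℕ → Gen e n
  | Psi : ℕ → Gen e n

variable (F : Type*) [Field F] (e n : ℕ) [NeZero e] (κ₁ κ₂ : ZMod e)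

/-- The entry of a residue sequence at the 1-indexed position `r` (junk value `0` out of
range). -/
def ent (i : Fin n → ZMod e) (r : ℕ) : ZMod e :=
  if h : 1 ≤ r ∧ r ≤ n then i ⟨r - 1, by omega⟩ else 0

/-- Swap the entries of a residue sequence at the 1-indexed positions `r` and `r + 1`. -/
def swapIdx (r : ℕ) (i : Fin n → ZMod e) : Fin n → ZMod e := fun k =>
  if (k : ℕ) + 1 = r then ent e n i (r + 1)
  else if (k : ℕ) = r then ent e n i r
  else i k

/-- The free algebra on the KLR generators. -/
abbrev FreeH := FreeAlgebra F (Gen e n)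

def fE (i : Fin n → ZMod e) : FreeH F e n := FreeAlgebra.ι F (Gen.E i)
def fY (r : ℕ) : FreeH F e n := FreeAlgebra.ι F (Gen.Y r)
def fPsi (r : ℕ) : FreeH F e n := FreeAlgebra.ι F (Gen.Psi r)

/-- The Kronecker delta `δ_{i_r, i_{r+1}}` as a scalar `0` or `1`. -/
def fDelta (i : Fin n → ZMod e) (r : ℕ) : FreeH F e n :=
  if ent e n i r = ent e n i (r + 1) then 1 else 0

/-- The exponent `(Λ, α_j)` in the cyclotomic relation: the number of `t ∈ {1,2}` with
`κ_t = j`. -/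
def cycDeg (j : ZMod e) : ℕ := (if κ₁ = j then 1 else 0) + (if κ₂ = j then 1 else 0)

/-- The defining relations of the cyclotomic KLR algebra `H_n^Λ` (for quantum
characteristic `e ≥ 3`), together with relations killing the out-of-range generators. -/
inductive Rel : FreeH F e n → FreeH F e n → Prop
  | idem (i j : Fin n → ZMod e) :
      Rel (fE F e n i * fE F e n j) (if i = j then fE F e n i else 0)
  | sum : Rel (∑ i : Fin n → ZMod e, fE F e n i) 1
  | yE (r : ℕ) (i : Fin n → ZMod e) :
      Rel (fY F e n r * fE F e n i) (fE F e n i * fY F e n r)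
  | psiE (r : ℕ) (i : Fin n → ZMod e) (h1 : 1 ≤ r) (h2 : r + 1 ≤ n) :
      Rel (fPsi F e n r * fE F e n i) (fE F e n (swapIdx e n r i) * fPsi F e n r)
  | yy (r s : ℕ) : Rel (fY F e n r * fY F e n s) (fY F e n s * fY F e n r)
  | psiY (r s : ℕ) (h1 : s ≠ r) (h2 : s ≠ r + 1) :
      Rel (fPsi F e n r * fY F e n s) (fY F e n s * fPsi F e n r)
  | psiPsi (r s : ℕ) (h : r + 1 < s) :
      Rel (fPsi F e n r * fPsi F e n s) (fPsi F e n s * fPsi F e n r)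
  | psiYup (r : ℕ) (i : Fin n → ZMod e) (h1 : 1 ≤ r) (h2 : r + 1 ≤ n) :
      Rel (fPsi F e n r * fY F e n (r + 1) * fE F e n i)
          ((fY F e n r * fPsi F e n r + fDelta F e n i r) * fE F e n i)
  | yPsiDown (r : ℕ) (i : Fin n → ZMod e) (h1 : 1 ≤ r) (h2 : r + 1 ≤ n) :
      Rel (fY F e n (r + 1) * fPsi F e n r * fE F e n i)
          ((fPsi F e n r * fY F e n r + fDelta F e n i r) * fE F e n i)
  | psiSq (r : ℕ) (i : Fin n → ZMod e) (h1 : 1 ≤ r) (h2 : r + 1 ≤ n) :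
      Rel (fPsi F e n r * fPsi F e n r * fE F e n i)
        ((if ent e n i (r + 1) = ent e n i r then 0
          else if ent e n i (r + 1) = ent e n i r + 1 then fY F e n (r + 1) - fY F e n r
          else if ent e n i (r + 1) = ent e n i r - 1 then fY F e n r - fY F e n (r + 1)
          else 1) * fE F e n i)
  | braid (r : ℕ) (i : Fin n → ZMod e) (h1 : 1 ≤ r) (h2 : r + 2 ≤ n) :
      Rel (fPsi F e n r * fPsi F e n (r + 1) * fPsi F e n r * fE F e n i)
        ((fPsi F e n (r + 1) * fPsi F e n r * fPsi F e n (r + 1) +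
          (if ent e n i (r + 2) = ent e n i r ∧ ent e n i (r + 1) = ent e n i r + 1
            then 1
            else if ent e n i (r + 2) = ent e n i r ∧ ent e n i (r + 1) = ent e n i r - 1
              then -1 else 0)) * fE F e n i)
  | cyc (i : Fin n → ZMod e) :
      Rel (fY F e n 1 ^ cycDeg e κ₁ κ₂ (ent e n i 1) * fE F e n i) 0
  | yRange (r : ℕ) (h : r = 0 ∨ n < r) : Rel (fY F e n r) 0
  | psiRange (r : ℕ) (h : r = 0 ∨ n ≤ r) : Rel (fPsi F e n r) 0

/-- The cyclotomic Khovanov--Lauda--Rouquier algebra `H = H_n^Λ` for the level-two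
multicharge `κ = (κ₁, κ₂)`. -/
abbrev H := RingQuot (Rel F e n κ₁ κ₂)

/-- The idempotent generator `e(i)` of `H`. -/
def eIdem (i : Fin n → ZMod e) : H F e n κ₁ κ₂ :=
  RingQuot.mkAlgHom F (Rel F e n κ₁ κ₂) (fE F e n i)

/-- The generator `y_r` of `H`. -/
def y (r : ℕ) : H F e n κ₁ κ₂ := RingQuot.mkAlgHom F (Rel F e n κ₁ κ₂) (fY F e n r)

/-- The generator `ψ_r` of `H`. -/
def ψgen (r : ℕ) : H F e n κ₁ κ₂ := RingQuot.mkAlgHom F (Rel F e n κ₁ κ₂) (fPsi F e n r)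

/-- `Ψ(j↓i) = ψ_j ψ_{j-1} ⋯ ψ_i` (equal to `1` when `j < i`). -/
def Psid (j i : ℕ) : H F e n κ₁ κ₂ :=
  ((List.range (j + 1 - i)).map fun t => ψgen F e n κ₁ κ₂ (j - t)).prod

/-- `Ψ(i↑j) = ψ_i ψ_{i+1} ⋯ ψ_j` (equal to `1` when `j < i`). -/
def Psiu (i j : ℕ) : H F e n κ₁ κ₂ :=
  ((List.range (j + 1 - i)).map fun t => ψgen F e n κ₁ κ₂ (i + t)).prod

/-- The residue sequence `i_λ` of the column-initial tableau of the hook bipartition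
`((n-m), (1^m))`: `(κ₂, κ₂-1, …, κ₂-m+1, κ₁, κ₁+1, …, κ₁+n-m-1)`. -/
def iLam (m : ℕ) : Fin n → ZMod e := fun k =>
  if (k : ℕ) < m then κ₂ - ((k : ℕ) : ZMod e) else κ₁ + (((k : ℕ) - m : ℕ) : ZMod e)

/-- The residue sequence `(κ, κ-1, …, κ-m, κ+1, κ+2, …, κ+n-m-1)` of the column-initial
tableau of a hook partition `(n-m, 1^m)` placed in a component with residue `κ` for its
first node. -/
def colIdx (κ : ZMod e) (m : ℕ) : Fin n → ZMod e := fun k =>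
  if (k : ℕ) ≤ m then κ - ((k : ℕ) : ZMod e) else κ + (((k : ℕ) - m : ℕ) : ZMod e)

/-- The defining relation elements of the Specht module `S_{((n-m),(1^m))}`. -/
def hookRels (m : ℕ) : Set (H F e n κ₁ κ₂) :=
  {x | x = 1 - eIdem F e n κ₁ κ₂ (iLam e n κ₁ κ₂ m)} ∪
  {x | ∃ r, 1 ≤ r ∧ r ≤ n ∧ x = y F e n κ₁ κ₂ r} ∪
  {x | ∃ r, 1 ≤ r ∧ r ≤ n - 1 ∧ r ≠ m ∧ x = ψgen F e n κ₁ κ₂ r}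

/-- The Specht module `S_m = S_{((n-m),(1^m))}`: the cyclic `H`-module generated by `z_m`
subject only to the defining relations. -/
abbrev Sp (m : ℕ) :=
  H F e n κ₁ κ₂ ⧸ Submodule.span (H F e n κ₁ κ₂) (hookRels F e n κ₁ κ₂ m)

/-- The standard generator `z_m` of `S_{((n-m),(1^m))}`. -/
def z (m : ℕ) : Sp F e n κ₁ κ₂ m := Submodule.Quotient.mk (1 : H F e n κ₁ κ₂)

/-- The defining relation elements of the Specht module `S'_m = S_{((n-m,1^m),∅)}`. -/
def armRels (m : ℕ) : Set (H F e n κ₁ κ₂) :=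
  {x | x = 1 - eIdem F e n κ₁ κ₂ (colIdx e n κ₁ m)} ∪
  {x | ∃ r, 1 ≤ r ∧ r ≤ n ∧ x = y F e n κ₁ κ₂ r} ∪
  {x | ∃ r, 1 ≤ r ∧ r ≤ n - 1 ∧ r ≠ m + 1 ∧ x = ψgen F e n κ₁ κ₂ r} ∪
  {x | x = Psiu F e n κ₁ κ₂ 1 (m + 1)}

/-- The Specht module `S'_m = S_{((n-m,1^m),∅)}`. -/
abbrev SpA (m : ℕ) :=
  H F e n κ₁ κ₂ ⧸ Submodule.span (H F e n κ₁ κ₂) (armRels F e n κ₁ κ₂ m)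

/-- The standard generator `z'_m` of `S_{((n-m,1^m),∅)}`. -/
def zA (m : ℕ) : SpA F e n κ₁ κ₂ m := Submodule.Quotient.mk (1 : H F e n κ₁ κ₂)

/-- The defining relation elements of the Specht module `S''_m = S_{(∅,(n-m,1^m))}`. -/
def legRels (m : ℕ) : Set (H F e n κ₁ κ₂) :=
  {x | x = 1 - eIdem F e n κ₁ κ₂ (colIdx e n κ₂ m)} ∪
  {x | ∃ r, 1 ≤ r ∧ r ≤ n ∧ x = y F e n κ₁ κ₂ r} ∪
  {x | ∃ r, 1 ≤ r ∧ r ≤ n - 1 ∧ r ≠ m + 1 ∧ x = ψgen F e n κ₁ κ₂ r} ∪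
  {x | x = Psiu F e n κ₁ κ₂ 1 (m + 1)}

/-- The Specht module `S''_m = S_{(∅,(n-m,1^m))}`. -/
abbrev SpB (m : ℕ) :=
  H F e n κ₁ κ₂ ⧸ Submodule.span (H F e n κ₁ κ₂) (legRels F e n κ₁ κ₂ m)

/-- The standard generator `z''_m` of `S_{(∅,(n-m,1^m))}`. -/
def zB (m : ℕ) : SpB F e n κ₁ κ₂ m := Submodule.Quotient.mk (1 : H F e n κ₁ κ₂)

/-- The standard basis vector `v(a₁,…,a_m) = Ψ(a₁-1↓1) Ψ(a₂-1↓2) ⋯ Ψ(a_m-1↓m) ⬝ z_m` of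
`S_{((n-m),(1^m))}`, where `a k` is the 1-indexed entry `a_{k+1}` of the leg. -/
def v (m : ℕ) (a : Fin m → ℕ) : Sp F e n κ₁ κ₂ m :=
  (((List.finRange m).map fun k => Psid F e n κ₁ κ₂ (a k - 1) ((k : ℕ) + 1)).prod)
    • z F e n κ₁ κ₂ m

/-- `a` records the leg entries `1 ≤ a₁ < a₂ < ⋯ < a_m ≤ n` of a standard
`((n-m),(1^m))`-tableau. -/
def StdLeg (m : ℕ) (a : Fin m → ℕ) : Prop :=
  StrictMono a ∧ (∀ k, 1 ≤ a k) ∧ ∀ k, a k ≤ n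

/-- A nonzero scalar multiple of a nonempty product of the generators `ψ_1, …, ψ_{n-1}`. -/
def IsPsiWord (x : H F e n κ₁ κ₂) : Prop :=
  ∃ (c : F) (L : List ℕ), c ≠ 0 ∧ L ≠ [] ∧ (∀ r ∈ L, 1 ≤ r ∧ r ≤ n - 1) ∧
    x = c • (L.map (ψgen F e n κ₁ κ₂)).prod

/-- The leg `(1, 2, …, m, n)` of the standard tableau labelling `v(1,…,m,n)`. -/
def gamTuple (m : ℕ) : Fin (m + 1) → ℕ := fun k => if (k : ℕ) < m then (k : ℕ) + 1 else n


section Relations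

variable {F e n κ₁ κ₂}

local notation "ψ" => ψgen F e n κ₁ κ₂
local notation "𝐲" => y F e n κ₁ κ₂
local notation "𝐞" => eIdem F e n κ₁ κ₂

theorem ψgen_range {r : ℕ} (h : r = 0 ∨ n ≤ r) : ψ r = 0 := by
  simpa [ψgen] using RingQuot.mkAlgHom_rel F (Rel.psiRange (F := F) (κ₁ := κ₁) (κ₂ := κ₂) r h)

theorem ψgen_comm {r s : ℕ} (h : r + 1 < s ∨ s + 1 < r) : ψ r * ψ s = ψ s * ψ r := by
  rcases h with h | h
  · simpa [ψgen] using
      RingQuot.mkAlgHom_rel F (Rel.psiPsi (F := F) (κ₁ := κ₁) (κ₂ := κ₂) r s h)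
  · simpa [ψgen] using
      (RingQuot.mkAlgHom_rel F (Rel.psiPsi (F := F) (κ₁ := κ₁) (κ₂ := κ₂) s r h)).symm

theorem eIdem_mul (i j : Fin n → ZMod e) : 𝐞 i * 𝐞 j = if i = j then 𝐞 i else 0 := by
  have := RingQuot.mkAlgHom_rel F (Rel.idem (F := F) (κ₁ := κ₁) (κ₂ := κ₂) i j)
  rw [map_mul] at this
  split_ifs at this ⊢ <;> simpa [eIdem] using this

theorem sum_eIdem : ∑ i, 𝐞 i = 1 := by
  simpa [eIdem] using
    RingQuot.mkAlgHom_rel F (Rel.sum (F := F) (e := e) (n := n) (κ₁ := κ₁) (κ₂ := κ₂))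

theorem ψgen_mul_eIdem {r : ℕ} (h1 : 1 ≤ r) (h2 : r + 1 ≤ n) (i : Fin n → ZMod e) :
    ψ r * 𝐞 i = 𝐞 (swapIdx e n r i) * ψ r := by
  simpa [ψgen, eIdem] using
    RingQuot.mkAlgHom_rel F (Rel.psiE (F := F) (κ₁ := κ₁) (κ₂ := κ₂) r i h1 h2)

variable {M : Type*} [AddCommGroup M] [Module (H F e n κ₁ κ₂) M] {x : M} {i : Fin n → ZMod e}

theorem eIdem_swapIdx_smul (hx : 𝐞 i • x = x) {r : ℕ} (h1 : 1 ≤ r) (h2 : r + 1 ≤ n) :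
    𝐞 (swapIdx e n r i) • ψ r • x = ψ r • x := by
  rw [smul_smul, ← ψgen_mul_eIdem h1 h2, mul_smul, hx]

theorem exists_eIdem_ψgen_smul (hx : 𝐞 i • x = x) (r : ℕ) :
    ∃ j, 𝐞 j • ψ r • x = ψ r • x := by
  by_cases h : r = 0 ∨ n ≤ r
  · exact ⟨i, by simp [ψgen_range h]⟩
  · exact ⟨_, eIdem_swapIdx_smul hx (by omega) (by omega)⟩

theorem ψgen_sq_smul_eq_zero (hx : 𝐞 i • x = x) {r : ℕ} (h1 : 1 ≤ r) (h2 : r + 1 ≤ n)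
    (hi : ent e n i (r + 1) = ent e n i r) : ψ r • ψ r • x = 0 := by
  have := RingQuot.mkAlgHom_rel F (Rel.psiSq (F := F) (κ₁ := κ₁) (κ₂ := κ₂) r i h1 h2)
  have := congrArg (· • x) this
  simp only [map_mul, if_pos hi, map_zero, zero_mul, zero_smul] at this
  change (ψ r * ψ r * 𝐞 i) • x = 0 at this
  simpa only [mul_smul, hx] using this

variable [Module F M]

theorem exists_ψgen_sq_smul (hx : 𝐞 i • x = x) {r : ℕ} (h1 : 1 ≤ r) (h2 : r + 1 ≤ n) :
    ∃ α β : F, ψ r • ψ r • x = α • x + β • (𝐲 (r + 1) • x - 𝐲 r • x) := by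
  have := RingQuot.mkAlgHom_rel F (Rel.psiSq (F := F) (κ₁ := κ₁) (κ₂ := κ₂) r i h1 h2)
  have := congrArg (· • x) this
  simp only [map_mul] at this
  change (ψ r * ψ r * 𝐞 i) • x = (_ * 𝐞 i) • x at this
  simp only [mul_smul, hx] at this
  rw [this]
  split_ifs
  · exact ⟨0, 0, by simp⟩
  · exact ⟨0, 1, by simp [sub_smul, y]⟩
  · exact ⟨0, -1, by simp [sub_smul, y]⟩
  · exact ⟨1, 0, by simp⟩

theorem exists_ψgen_braid_smul (hx : 𝐞 i • x = x) {r : ℕ} (h1 : 1 ≤ r) (h2 : r + 2 ≤ n) :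
    ∃ α : F, ψ r • ψ (r + 1) • ψ r • x = ψ (r + 1) • ψ r • ψ (r + 1) • x + α • x := by
  have := RingQuot.mkAlgHom_rel F (Rel.braid (F := F) (κ₁ := κ₁) (κ₂ := κ₂) r i h1 h2)
  have := congrArg (· • x) this
  simp only [map_mul, map_add] at this
  change (ψ r * ψ (r + 1) * ψ r * 𝐞 i) • x =
    ((ψ (r + 1) * ψ r * ψ (r + 1) + _) * 𝐞 i) • x at this
  simp only [mul_smul, add_smul, hx] at this
  rw [this]
  split_ifs
  · exact ⟨1, by simp⟩
  · exact ⟨-1, by simp⟩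
  · exact ⟨0, by simp⟩

theorem exists_y_ψgen_smul (hx : 𝐞 i • x = x) (r s : ℕ) :
    ∃ (t : ℕ) (d : F), 𝐲 r • ψ s • x = ψ s • 𝐲 t • x + d • x := by
  by_cases h : s = 0 ∨ n ≤ s
  · exact ⟨0, 0, by simp [ψgen_range h]⟩
  have h1 : 1 ≤ s := by omega
  have h2 : s + 1 ≤ n := by omega
  by_cases hr : r = s + 1
  · subst hr
    have := RingQuot.mkAlgHom_rel F (Rel.yPsiDown (F := F) (κ₁ := κ₁) (κ₂ := κ₂) s i h1 h2)
    have := congrArg (· • x) this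
    refine ⟨s, if ent e n i s = ent e n i (s + 1) then 1 else 0, ?_⟩
    simp only [map_mul, map_add] at this
    change (𝐲 (s + 1) * ψ s * 𝐞 i) • x = ((ψ s * 𝐲 s + _) * 𝐞 i) • x at this
    simp only [mul_smul, add_smul, hx] at this
    rw [this, fDelta]
    split_ifs <;> simp
  by_cases hs : r = s
  · subst hs
    have := RingQuot.mkAlgHom_rel F (Rel.psiYup (F := F) (κ₁ := κ₁) (κ₂ := κ₂) r i h1 h2)
    have := congrArg (· • x) this
    refine ⟨r + 1, if ent e n i r = ent e n i (r + 1) then -1 else 0, ?_⟩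
    simp only [map_mul, map_add] at this
    change (ψ r * 𝐲 (r + 1) * 𝐞 i) • x = ((𝐲 r * ψ r + _) * 𝐞 i) • x at this
    simp only [mul_smul, add_smul, hx] at this
    rw [this, fDelta]
    split_ifs <;> simp
  · have := RingQuot.mkAlgHom_rel F (Rel.psiY (F := F) (n := n) (κ₁ := κ₁) (κ₂ := κ₂) s r hs hr)
    have := congrArg (· • x) this
    simp only [map_mul] at this
    change (ψ s * 𝐲 r) • x = (𝐲 r * ψ s) • x at this
    exact ⟨r, 0, by simpa [mul_smul] using this.symm⟩

end Relations

section Legs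

variable {n} {m : ℕ} {a : Fin m → ℕ} {r : ℕ}

/-- Interchange the entries `r` and `r + 1` in a leg. -/
def legSwap (r : ℕ) (a : Fin m → ℕ) : Fin m → ℕ := fun k => Equiv.swap r (r + 1) (a k)

/-- The leg `(1, 2, …, m)` of the initial tableau. -/
def initLeg (m : ℕ) : Fin m → ℕ := fun k => k + 1

theorem legSwap_legSwap (r : ℕ) (a : Fin m → ℕ) : legSwap r (legSwap r a) = a := by
  ext k; simp [legSwap]

theorem legSwap_injective (r : ℕ) : Function.Injective (legSwap (m := m) r) :=
  Function.LeftInverse.injective (legSwap_legSwap r)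

theorem mem_range_legSwap {p : ℕ} :
    p ∈ Set.range (legSwap r a) ↔ Equiv.swap r (r + 1) p ∈ Set.range a := by
  simp only [Set.mem_range, legSwap]
  refine exists_congr fun k => ?_
  rw [Equiv.swap_apply_eq_iff]

theorem left_mem_range_legSwap : r ∈ Set.range (legSwap r a) ↔ r + 1 ∈ Set.range a := by
  rw [mem_range_legSwap, Equiv.swap_apply_left]

theorem right_mem_range_legSwap : r + 1 ∈ Set.range (legSwap r a) ↔ r ∈ Set.range a := by
  rw [mem_range_legSwap, Equiv.swap_apply_right]

theorem mem_range_legSwap_of_ne {p : ℕ} (h : p ≠ r) (h' : p ≠ r + 1) :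
    p ∈ Set.range (legSwap r a) ↔ p ∈ Set.range a := by
  rw [mem_range_legSwap, Equiv.swap_apply_of_ne_of_ne h h']

theorem StdLeg.legSwap (ha : StdLeg n m a) (h1 : 1 ≤ r) (h2 : r + 1 ≤ n)
    (h : ¬(r ∈ Set.range a ∧ r + 1 ∈ Set.range a)) : StdLeg n m (legSwap r a) := by
  refine ⟨fun i j hij => ?_, fun k => ?_, fun k => ?_⟩
  · have h3 := ha.1 hij
    have h4 : ¬(a i = r ∧ a j = r + 1) := fun h5 => h ⟨⟨i, h5.1⟩, ⟨j, h5.2⟩⟩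
    simp only [KLRHook.legSwap, Equiv.swap_apply_def]
    split_ifs <;> omega
  · have h3 := ha.2.1 k
    simp only [KLRHook.legSwap, Equiv.swap_apply_def]
    split_ifs <;> omega
  · have h3 := ha.2.2 k
    simp only [KLRHook.legSwap, Equiv.swap_apply_def]
    split_ifs <;> omega

theorem StdLeg.add_one_le (ha : StdLeg n m a) (k : Fin m) : (k : ℕ) + 1 ≤ a k := by
  obtain ⟨k, hk⟩ := k
  induction k with
  | zero => exact ha.2.1 _
  | succ k ih =>
    have h1 := ih (by omega)
    have h2 : a ⟨k, by omega⟩ < a ⟨k + 1, hk⟩ := ha.1 (by simp)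
    simp only at h1 ⊢
    omega

theorem stdLeg_initLeg (hm : m ≤ n) : StdLeg n m (initLeg m) := by
  refine ⟨fun i j hij => ?_, fun k => ?_, fun k => ?_⟩ <;> simp only [initLeg] <;> omega

theorem mem_range_initLeg {p : ℕ} : p ∈ Set.range (initLeg m) ↔ 1 ≤ p ∧ p ≤ m := by
  simp only [Set.mem_range, initLeg]
  constructor
  · rintro ⟨k, rfl⟩; omega
  · rintro ⟨h1, h2⟩
    exact ⟨⟨p - 1, by omega⟩, by simp only; omega⟩

theorem StdLeg.exists_descent (ha : StdLeg n m a) (h : a ≠ initLeg m) :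
    ∃ r, 1 ≤ r ∧ r + 1 ≤ n ∧ r ∉ Set.range a ∧ r + 1 ∈ Set.range a := by
  have h0 : ∃ k : ℕ, ∃ hk : k < m, a ⟨k, hk⟩ ≠ k + 1 := by
    by_contra! h'
    exact h (funext fun k => h' k k.2)
  classical
  obtain ⟨hk, hne⟩ := Nat.find_spec h0
  have hmin := fun l (hl : l < Nat.find h0) => Nat.find_min h0 hl
  generalize Nat.find h0 = k at hk hne hmin
  have h1 := ha.add_one_le ⟨k, hk⟩
  have h2 := ha.2.2 ⟨k, hk⟩
  simp only at h1
  refine ⟨a ⟨k, hk⟩ - 1, by omega, by omega, ?_, ⟨⟨k, hk⟩, by omega⟩⟩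
  rintro ⟨⟨l, hl⟩, h3⟩
  rcases lt_trichotomy l k with h4 | rfl | h4
  · have := hmin l h4
    push Not at this
    have := this hl
    omega
  · omega
  · have : a ⟨k, hk⟩ < a ⟨l, hl⟩ := ha.1 (by simpa using h4)
    omega

theorem sum_legSwap (ha : StdLeg n m a) (h : r ∈ Set.range a) (h' : r + 1 ∉ Set.range a) :
    ∑ k, legSwap r a k = ∑ k, a k + 1 := by
  obtain ⟨j, rfl⟩ := h
  have h1 : ∀ k, legSwap (a j) a k = a k + if k = j then 1 else 0 := fun k => by
    have h2 : a k ≠ a j + 1 := fun h3 => h' ⟨k, h3⟩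
    have h3 : a k = a j ↔ k = j := ha.1.injective.eq_iff
    by_cases h4 : k = j
    · simp [legSwap, h4]
    · simp [legSwap, Equiv.swap_apply_of_ne_of_ne (mt h3.1 h4) h2, h4]
  simp [h1, Finset.sum_add_distrib]

/-- The number of leg entries smaller than `p`. -/
def legCount (a : Fin m → ℕ) (p : ℕ) : ℕ := (Finset.univ.filter fun k => a k < p).card

theorem legCount_zero (a : Fin m → ℕ) : legCount a 0 = 0 := by simp [legCount]

theorem legCount_succ_of_mem (ha : StrictMono a) {p : ℕ} (h : p ∈ Set.range a) :
    legCount a (p + 1) = legCount a p + 1 := by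
  obtain ⟨j, rfl⟩ := h
  have : (Finset.univ.filter fun k => a k < a j + 1) =
      insert j (Finset.univ.filter fun k => a k < a j) := by
    ext k
    simp [Order.lt_add_one_iff, le_iff_lt_or_eq, ha.injective.eq_iff, or_comm]
  rw [legCount, this, Finset.card_insert_of_notMem (by simp), legCount]

theorem legCount_succ_of_notMem {p : ℕ} (h : p ∉ Set.range a) :
    legCount a (p + 1) = legCount a p := by
  have h1 : ∀ k, a k ≠ p := fun k hk => h ⟨k, hk⟩
  simp [legCount, Order.lt_add_one_iff, le_iff_lt_or_eq, h1]

theorem legCount_top (ha : StdLeg n m a) : legCount a (n + 1) = m := by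
  simp [legCount, ha.2.2]

theorem legCount_congr {b : Fin m → ℕ} (ha : StrictMono a) (hb : StrictMono b) {p : ℕ}
    (h : ∀ q < p, q ∈ Set.range a ↔ q ∈ Set.range b) : legCount a p = legCount b p := by
  induction p with
  | zero => simp only [legCount_zero]
  | succ p ih =>
    have h1 := ih fun q hq => h q (by omega)
    have h2 := h p (by omega)
    by_cases h3 : p ∈ Set.range a
    · rw [legCount_succ_of_mem ha h3, legCount_succ_of_mem hb (h2.1 h3), h1]
    · rw [legCount_succ_of_notMem h3, legCount_succ_of_notMem (mt h2.2 h3), h1]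

theorem legCount_initLeg (m p : ℕ) : legCount (initLeg m) (p + 1) = min p m := by
  have hs : StrictMono (initLeg m) := (stdLeg_initLeg le_rfl).1
  induction p with
  | zero =>
    rw [legCount_succ_of_notMem (by rw [mem_range_initLeg]; omega), legCount_zero, Nat.zero_min]
  | succ p ih =>
    by_cases h : p + 1 ≤ m
    · rw [legCount_succ_of_mem hs (by rw [mem_range_initLeg]; omega), ih]
      omega
    · rw [legCount_succ_of_notMem (by rw [mem_range_initLeg]; omega), ih]
      omega

theorem legCount_legSwap (ha : StdLeg n m a) (hs : StdLeg n m (legSwap r a))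
    (h : r ∈ Set.range a) (h' : r + 1 ∉ Set.range a) {p : ℕ} (hp : p ≠ r + 1) :
    legCount (legSwap r a) p = legCount a p := by
  have hlow : ∀ p ≤ r, legCount (legSwap r a) p = legCount a p := fun p hp =>
    legCount_congr hs.1 ha.1 fun q hq => mem_range_legSwap_of_ne (by omega) (by omega)
  rcases Nat.lt_or_ge r p with hrp | hrp
  · obtain ⟨t, rfl⟩ : ∃ t, p = r + 1 + 1 + t := ⟨p - (r + 2), by omega⟩
    clear hp hrp
    induction t with
    | zero =>
      rw [Nat.add_zero, legCount_succ_of_mem hs.1 (right_mem_range_legSwap.2 h),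
        legCount_succ_of_notMem (mt left_mem_range_legSwap.1 h'), hlow r le_rfl,
        legCount_succ_of_notMem h', legCount_succ_of_mem ha.1 h]
    | succ t ih =>
      have hq : r + 1 + 1 + t ∈ Set.range (legSwap r a) ↔ r + 1 + 1 + t ∈ Set.range a :=
        mem_range_legSwap_of_ne (by omega) (by omega)
      rw [← Nat.add_assoc]
      by_cases hm : r + 1 + 1 + t ∈ Set.range a
      · rw [legCount_succ_of_mem hs.1 (hq.2 hm), legCount_succ_of_mem ha.1 hm, ih]
      · rw [legCount_succ_of_notMem (mt hq.1 hm), legCount_succ_of_notMem hm, ih]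
  · exact hlow p hrp

end Legs

section Residues

variable {e n : ℕ} {κ₁ κ₂ : ZMod e} {m : ℕ} {a : Fin m → ℕ} {r : ℕ}

variable (e κ₁ κ₂) in
open Classical in
/-- The residue of the node with entry `p` in the tableau with leg `a`. -/
noncomputable def resAt (a : Fin m → ℕ) (p : ℕ) : ZMod e :=
  if p ∈ Set.range a then κ₂ - (legCount a p : ZMod e)
  else κ₁ + (p : ZMod e) - 1 - (legCount a p : ZMod e)

variable (e n κ₁ κ₂) in
/-- The residue sequence of the tableau with leg `a`. -/
noncomputable def legRes (a : Fin m → ℕ) : Fin n → ZMod e := fun k => resAt e κ₁ κ₂ a (k + 1)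

theorem resAt_of_mem {p : ℕ} (h : p ∈ Set.range a) :
    resAt e κ₁ κ₂ a p = κ₂ - (legCount a p : ZMod e) := if_pos h

theorem resAt_of_notMem {p : ℕ} (h : p ∉ Set.range a) :
    resAt e κ₁ κ₂ a p = κ₁ + (p : ZMod e) - 1 - (legCount a p : ZMod e) := if_neg h

theorem ent_legRes (h1 : 1 ≤ r) (h2 : r ≤ n) :
    ent e n (legRes e n κ₁ κ₂ a) r = resAt e κ₁ κ₂ a r := by
  rw [ent, dif_pos ⟨h1, h2⟩, legRes]
  congr 1
  simp only
  omega

theorem legRes_initLeg : legRes e n κ₁ κ₂ (initLeg m) = iLam e n κ₁ κ₂ m := by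
  funext k
  rw [legRes, iLam]
  split_ifs with h
  · rw [resAt_of_mem (by rw [mem_range_initLeg]; omega), legCount_initLeg, min_eq_left h.le]
  · push Not at h
    rw [resAt_of_notMem (by rw [mem_range_initLeg]; omega), legCount_initLeg, min_eq_right h,
      Nat.cast_sub h]
    push_cast
    ring

theorem swapIdx_legRes (ha : StdLeg n m a) (h1 : 1 ≤ r) (h2 : r + 1 ≤ n)
    (h : r ∈ Set.range a) (h' : r + 1 ∉ Set.range a) :
    swapIdx e n r (legRes e n κ₁ κ₂ a) = legRes e n κ₁ κ₂ (legSwap r a) := by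
  have hs : StdLeg n m (legSwap r a) := ha.legSwap h1 h2 fun h3 => h' h3.2
  funext k
  rw [swapIdx]
  split_ifs with h3 h4
  · rw [ent_legRes (by omega) (by omega), legRes, h3, resAt_of_notMem h',
      resAt_of_notMem (mt left_mem_range_legSwap.1 h'),
      legCount_legSwap ha hs h h' (by omega), legCount_succ_of_mem ha.1 h]
    push_cast
    ring
  · rw [ent_legRes (by omega) (by omega), legRes, h4, resAt_of_mem h,
      resAt_of_mem (right_mem_range_legSwap.2 h),
      legCount_succ_of_notMem (mt left_mem_range_legSwap.1 h'),
      legCount_legSwap ha hs h h' (by omega)]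
  · have h5 := mem_range_legSwap_of_ne (a := a) (r := r) (p := k + 1) h3 (by omega)
    rw [legRes, legRes]
    by_cases h6 : (k : ℕ) + 1 ∈ Set.range a
    · rw [resAt_of_mem h6, resAt_of_mem (h5.2 h6), legCount_legSwap ha hs h h' (by omega)]
    · rw [resAt_of_notMem h6, resAt_of_notMem (mt h5.1 h6),
        legCount_legSwap ha hs h h' (by omega)]

theorem one_ne_zero_of_three_le (he : 3 ≤ e) : (1 : ZMod e) ≠ 0 := by
  have : Fact (1 < e) := ⟨by omega⟩
  exact one_ne_zero

theorem two_ne_zero_of_three_le (he : 3 ≤ e) : (2 : ZMod e) ≠ 0 := by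
  intro h
  have h1 : ((2 : ℕ) : ZMod e) = 0 := by exact_mod_cast h
  rw [ZMod.natCast_eq_zero_iff] at h1
  have := Nat.le_of_dvd (by norm_num) h1
  omega

/-- Consecutive entries of equal residue lie one in the leg and one in the arm. -/
theorem mem_iff_notMem_of_resAt_eq (he : 3 ≤ e) (ha : StdLeg n m a)
    (h : resAt e κ₁ κ₂ a (r + 1) = resAt e κ₁ κ₂ a r) :
    r + 1 ∈ Set.range a ↔ r ∉ Set.range a := by
  have h1 := one_ne_zero_of_three_le he
  by_cases h2 : r ∈ Set.range a <;> by_cases h3 : r + 1 ∈ Set.range a <;>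
    simp only [h2, h3, not_true, not_false_iff, iff_self, iff_false, iff_true]
  · rw [resAt_of_mem h2, resAt_of_mem h3, legCount_succ_of_mem ha.1 h2] at h
    push_cast at h
    exact h1 (by linear_combination -h)
  · rw [resAt_of_notMem h2, resAt_of_notMem h3, legCount_succ_of_notMem h2] at h
    push_cast at h
    exact h1 (by linear_combination h)

theorem exists_resAt_eq_of_first_diff (he : 3 ≤ e) {b : Fin m → ℕ} (ha : StdLeg n m a)
    (hb : StdLeg n m b) (hres : legRes e n κ₁ κ₂ a = legRes e n κ₁ κ₂ b) {p : ℕ}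
    (hlt : ∀ q < p, q ∈ Set.range a ↔ q ∈ Set.range b) (hpa : p ∈ Set.range a)
    (hpb : p ∉ Set.range b) :
    1 ≤ p ∧ p + 1 ≤ n ∧ resAt e κ₁ κ₂ a (p + 1) = resAt e κ₁ κ₂ a p := by
  have h1 := one_ne_zero_of_three_le he
  have h2 := two_ne_zero_of_three_le he
  have hc := legCount_congr ha.1 hb.1 hlt
  have hca := legCount_succ_of_mem ha.1 hpa
  have hcb := legCount_succ_of_notMem hpb
  have hp1 : 1 ≤ p := by obtain ⟨k, rfl⟩ := hpa; exact ha.2.1 k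
  have hpn : p ≤ n := by obtain ⟨k, rfl⟩ := hpa; exact ha.2.2 k
  have hr : ∀ q, 1 ≤ q → q ≤ n → resAt e κ₁ κ₂ a q = resAt e κ₁ κ₂ b q := fun q h3 h4 => by
    rw [← ent_legRes h3 h4, hres, ent_legRes h3 h4]
  have hpn' : p + 1 ≤ n := by
    by_contra h3
    obtain rfl : p = n := by omega
    rw [legCount_top ha] at hca
    rw [legCount_top hb] at hcb
    omega
  have e1 := hr p hp1 hpn
  have e2 := hr (p + 1) (by omega) hpn'
  refine ⟨hp1, hpn', ?_⟩
  rw [resAt_of_mem hpa] at e1 ⊢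
  rw [resAt_of_notMem hpb, ← hc] at e1
  by_cases h3 : p + 1 ∈ Set.range a
  · exfalso
    rw [resAt_of_mem h3, hca] at e2
    by_cases h4 : p + 1 ∈ Set.range b
    · rw [resAt_of_mem h4, hcb, ← hc] at e2
      push_cast at e2
      exact h1 (by linear_combination -e2)
    · rw [resAt_of_notMem h4, hcb, ← hc] at e2
      push_cast at e2
      exact h2 (by linear_combination e1 - e2)
  · rw [resAt_of_notMem h3, hca]
    push_cast
    linear_combination -e1

/-- Distinct tableaux with the same residue sequence differ at a pair of consecutive entries
of equal residue. -/
theorem exists_resAt_eq (he : 3 ≤ e) {b : Fin m → ℕ} (ha : StdLeg n m a)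
    (hb : StdLeg n m b) (hres : legRes e n κ₁ κ₂ a = legRes e n κ₁ κ₂ b) (hab : a ≠ b) :
    ∃ r, 1 ≤ r ∧ r + 1 ≤ n ∧ resAt e κ₁ κ₂ a (r + 1) = resAt e κ₁ κ₂ a r ∧
      ¬(r ∈ Set.range a ↔ r ∈ Set.range b) := by
  have h0 : ∃ p, ¬(p ∈ Set.range a ↔ p ∈ Set.range b) := by
    by_contra! h
    exact hab ((ha.1.range_inj hb.1).1 (Set.ext h))
  classical
  have hp := Nat.find_spec h0
  have hmin : ∀ q < Nat.find h0, q ∈ Set.range a ↔ q ∈ Set.range b := fun q hq =>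
    not_not.1 (Nat.find_min h0 hq)
  generalize Nat.find h0 = p at hp hmin
  by_cases hpa : p ∈ Set.range a
  · have hpb : p ∉ Set.range b := fun h => hp ⟨fun _ => h, fun _ => hpa⟩
    obtain ⟨h1, h2, h3⟩ := exists_resAt_eq_of_first_diff he ha hb hres hmin hpa hpb
    exact ⟨p, h1, h2, h3, hp⟩
  · have hpb : p ∈ Set.range b := by_contra fun h => hp ⟨fun h' => (hpa h').elim,
      fun h' => (h h').elim⟩
    obtain ⟨h1, h2, h3⟩ := exists_resAt_eq_of_first_diff he hb ha hres.symm
      (fun q hq => (hmin q hq).symm) hpb hpa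
    refine ⟨p, h1, h2, ?_, hp⟩
    rw [← ent_legRes (n := n) (by omega) h2, ← ent_legRes (n := n) h1 (by omega)] at h3 ⊢
    rwa [hres]

end Residues

section Specht

variable {F e n κ₁ κ₂} {m : ℕ} {a : Fin m → ℕ} {r : ℕ}

local notation "ψ" => ψgen F e n κ₁ κ₂
local notation "𝐲" => y F e n κ₁ κ₂
local notation "𝐞" => eIdem F e n κ₁ κ₂
local notation "𝐯" => v F e n κ₁ κ₂ m
local notation "𝐳" => z F e n κ₁ κ₂ m

theorem smul_z_eq_zero {h : H F e n κ₁ κ₂} (hh : h ∈ hookRels F e n κ₁ κ₂ m) : h • 𝐳 = 0 := by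
  rw [z, ← Submodule.Quotient.mk_smul, smul_eq_mul, mul_one]
  exact (Submodule.Quotient.mk_eq_zero _).2 (Submodule.subset_span hh)

theorem eIdem_smul_z : 𝐞 (iLam e n κ₁ κ₂ m) • 𝐳 = 𝐳 := by
  have : (1 - 𝐞 (iLam e n κ₁ κ₂ m)) • 𝐳 = 0 := smul_z_eq_zero (Or.inl (Or.inl rfl))
  rw [sub_smul, one_smul, sub_eq_zero] at this
  exact this.symm

theorem y_smul_z (r : ℕ) : 𝐲 r • 𝐳 = 0 := by
  by_cases h : r = 0 ∨ n < r
  · have : 𝐲 r = 0 := by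
      simpa [y] using RingQuot.mkAlgHom_rel F (Rel.yRange (F := F) (κ₁ := κ₁) (κ₂ := κ₂) r h)
    rw [this, zero_smul]
  · exact smul_z_eq_zero (Or.inl (Or.inr ⟨r, by omega, by omega, rfl⟩))

theorem ψgen_smul_z (h : r ≠ m) : ψ r • 𝐳 = 0 := by
  by_cases h' : r = 0 ∨ n ≤ r
  · rw [ψgen_range h', zero_smul]
  · exact smul_z_eq_zero (Or.inr ⟨r, by omega, by omega, h, rfl⟩)

theorem v_initLeg : 𝐯 (initLeg m) = 𝐳 := by
  have : ∀ k : Fin m, Psid F e n κ₁ κ₂ (initLeg m k - 1) ((k : ℕ) + 1) = 1 := fun k => by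
    simp [Psid, initLeg]
  rw [v, List.prod_eq_one, one_smul]
  simp [this]

theorem ψgen_mul_Psid {j : ℕ} (h1 : 1 ≤ r) (hj : j ≤ r) :
    ψ r * Psid F e n κ₁ κ₂ (r - 1) j = Psid F e n κ₁ κ₂ r j := by
  obtain ⟨t, ht⟩ : ∃ t, r + 1 - j = t + 1 := ⟨r - j, by omega⟩
  rw [Psid, Psid, ht, show r - 1 + 1 - j = t by omega, List.range_succ_eq_map, List.map_cons,
    List.prod_cons, Nat.sub_zero, List.map_map]
  congr 3
  funext s
  simp only [Function.comp_apply]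
  congr 1
  omega

theorem commute_ψgen_Psid {j i : ℕ} (h : j + 1 < r) :
    Commute (ψ r) (Psid F e n κ₁ κ₂ j i) := by
  rw [Psid]
  refine Commute.list_prod_right _ _ fun x hx => ?_
  obtain ⟨t, -, rfl⟩ := List.mem_map.1 hx
  exact ψgen_comm (Or.inr (by omega))

/-- Changing one factor of a product by left multiplication with an element commuting with all
the preceding factors. -/
theorem prod_finRange_eq_mul {A : Type*} [Monoid A] {m : ℕ} (x : A) (f g : Fin m → A)
    (j : Fin m) (hc : ∀ i < j, Commute x (f i)) (hj : g j = x * f j)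
    (hne : ∀ i, i ≠ j → g i = f i) :
    ((List.finRange m).map g).prod = x * ((List.finRange m).map f).prod := by
  induction m with
  | zero => exact j.elim0
  | succ m ih =>
    simp only [List.finRange_succ, List.map_cons, List.prod_cons, List.map_map]
    induction j using Fin.cases with
    | zero =>
      rw [hj, mul_assoc]
      congr 4
      funext i
      exact hne _ (Fin.succ_ne_zero i)
    | succ j =>
      rw [hne 0 (Fin.succ_ne_zero j).symm,
        ih (f ∘ Fin.succ) (g ∘ Fin.succ) j (fun i hi => hc _ (Fin.succ_lt_succ_iff.2 hi)) hj
          (fun i hi => hne _ (by simpa using hi)),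
        ← mul_assoc, ← mul_assoc, (hc 0 (Fin.succ_pos j)).eq]

theorem v_legSwap (ha : StdLeg n m a) (h : r ∈ Set.range a) (h' : r + 1 ∉ Set.range a) :
    𝐯 (legSwap r a) = ψ r • 𝐯 a := by
  obtain ⟨j, rfl⟩ := h
  rw [v, v, smul_smul]
  congr 1
  refine prod_finRange_eq_mul _ _ _ j (fun i hi => ?_) ?_ fun i hi => ?_
  · have h1 := ha.1 hi
    have h2 := ha.2.1 i
    exact commute_ψgen_Psid (by omega)
  · simp only [legSwap, Equiv.swap_apply_left, Nat.add_sub_cancel]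
    exact (ψgen_mul_Psid (ha.2.1 j) (ha.add_one_le j)).symm
  · rw [legSwap, Equiv.swap_apply_of_ne_of_ne (fun h3 => hi (ha.1.injective h3))
      fun h3 => h' ⟨i, h3⟩]

/-- A non-initial standard leg arises from a smaller one by a swap. -/
theorem StdLeg.exists_legSwap (ha : StdLeg n m a) (h1 : 1 ≤ r) (h2 : r + 1 ≤ n)
    (h : r ∉ Set.range a) (h' : r + 1 ∈ Set.range a) :
    ∃ b, StdLeg n m b ∧ r ∈ Set.range b ∧ r + 1 ∉ Set.range b ∧ a = KLRHook.legSwap r b ∧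
      ∑ k, a k = ∑ k, b k + 1 := by
  have hb := ha.legSwap h1 h2 fun h3 => h h3.1
  have h3 := left_mem_range_legSwap.2 h'
  have h4 := mt right_mem_range_legSwap.1 h
  refine ⟨KLRHook.legSwap r a, hb, h3, h4, (legSwap_legSwap r a).symm, ?_⟩
  rw [← sum_legSwap hb h3 h4, legSwap_legSwap]

theorem eIdem_smul_v (ha : StdLeg n m a) : 𝐞 (legRes e n κ₁ κ₂ a) • 𝐯 a = 𝐯 a := by
  induction hs : ∑ k, a k using Nat.strong_induction_on generalizing a with
  | _ s ih =>
    by_cases h0 : a = initLeg m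
    · rw [h0, legRes_initLeg, v_initLeg, eIdem_smul_z]
    obtain ⟨r, h1, h2, h3, h4⟩ := ha.exists_descent h0
    obtain ⟨b, hb, h5, h6, rfl, h7⟩ := ha.exists_legSwap h1 h2 h3 h4
    rw [← swapIdx_legRes hb h1 h2 h5 h6, v_legSwap hb h5 h6]
    exact eIdem_swapIdx_smul (ih _ (by omega) hb rfl) h1 h2

variable (F e n κ₁ κ₂ m) in
/-- The span of the vectors `ψ_{r₁} ⋯ ψ_{r_l} z_m` with `l + (1 + ⋯ + m) < k`; the shift makes
`v(a₁,…,a_m)` lie in the step `a₁ + ⋯ + a_m + 1`. -/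
def wordFilt (k : ℕ) : Submodule F (Sp F e n κ₁ κ₂ m) :=
  Submodule.span F
    {x | ∃ L : List ℕ, L.length + ∑ j, initLeg m j < k ∧ x = (L.map ψ).prod • 𝐳}

theorem wordFilt_mono {k l : ℕ} (h : k ≤ l) :
    wordFilt F e n κ₁ κ₂ m k ≤ wordFilt F e n κ₁ κ₂ m l :=
  Submodule.span_mono fun _ ⟨L, hL, hx⟩ => ⟨L, by omega, hx⟩

theorem smul_mem_of_span {h : H F e n κ₁ κ₂} {S : Set (Sp F e n κ₁ κ₂ m)}
    {V : Submodule F (Sp F e n κ₁ κ₂ m)} (hS : ∀ x ∈ S, h • x ∈ V) {x : Sp F e n κ₁ κ₂ m}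
    (hx : x ∈ Submodule.span F S) : h • x ∈ V := by
  induction hx using Submodule.span_induction with
  | mem x hx => exact hS x hx
  | zero => rw [smul_zero]; exact V.zero_mem
  | add x y _ _ hx hy => rw [smul_add]; exact V.add_mem hx hy
  | smul c x _ hx => rw [smul_comm]; exact V.smul_mem c hx

theorem ψgen_smul_mem_wordFilt (r : ℕ) {k : ℕ} {x : Sp F e n κ₁ κ₂ m}
    (hx : x ∈ wordFilt F e n κ₁ κ₂ m k) : ψ r • x ∈ wordFilt F e n κ₁ κ₂ m (k + 1) := by
  refine smul_mem_of_span ?_ hx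
  rintro _ ⟨L, hL, rfl⟩
  refine Submodule.subset_span ⟨r :: L, by rw [List.length_cons]; omega, ?_⟩
  rw [List.map_cons, List.prod_cons, mul_smul]

theorem exists_eIdem_word_smul_z (L : List ℕ) :
    ∃ i, 𝐞 i • (L.map ψ).prod • 𝐳 = (L.map ψ).prod • 𝐳 := by
  induction L with
  | nil => exact ⟨_, by rw [List.map_nil, List.prod_nil, one_smul, eIdem_smul_z]⟩
  | cons r L ih =>
    obtain ⟨i, hi⟩ := ih
    rw [List.map_cons, List.prod_cons, mul_smul]
    exact exists_eIdem_ψgen_smul hi r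

theorem y_smul_word_smul_z (r : ℕ) (L : List ℕ) :
    𝐲 r • (L.map ψ).prod • 𝐳 ∈ wordFilt F e n κ₁ κ₂ m (L.length + ∑ j, initLeg m j) := by
  induction L generalizing r with
  | nil =>
    rw [List.map_nil, List.prod_nil, one_smul, y_smul_z]
    exact Submodule.zero_mem _
  | cons s L ih =>
    obtain ⟨i, hi⟩ := exists_eIdem_word_smul_z (F := F) (n := n) (m := m) (κ₁ := κ₁)
      (κ₂ := κ₂) L
    rw [List.map_cons, List.prod_cons, mul_smul]
    obtain ⟨t, d, h⟩ := exists_y_ψgen_smul (F := F) hi r s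
    rw [h, List.length_cons, Nat.add_right_comm]
    exact Submodule.add_mem _ (ψgen_smul_mem_wordFilt s (ih t))
      (Submodule.smul_mem _ _ (Submodule.subset_span ⟨L, by omega, rfl⟩))

theorem y_smul_mem_wordFilt (r : ℕ) {k : ℕ} {x : Sp F e n κ₁ κ₂ m}
    (hx : x ∈ wordFilt F e n κ₁ κ₂ m (k + 1)) : 𝐲 r • x ∈ wordFilt F e n κ₁ κ₂ m k := by
  refine smul_mem_of_span ?_ hx
  rintro _ ⟨L, hL, rfl⟩
  exact wordFilt_mono (by omega) (y_smul_word_smul_z r L)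

theorem eIdem_smul_mem_wordFilt (i : Fin n → ZMod e) {k : ℕ} {x : Sp F e n κ₁ κ₂ m}
    (hx : x ∈ wordFilt F e n κ₁ κ₂ m k) : 𝐞 i • x ∈ wordFilt F e n κ₁ κ₂ m k := by
  refine smul_mem_of_span ?_ hx
  rintro _ ⟨L, hL, rfl⟩
  obtain ⟨j, hj⟩ := exists_eIdem_word_smul_z (F := F) (n := n) (m := m) (κ₁ := κ₁)
    (κ₂ := κ₂) L
  rw [← hj, smul_smul, eIdem_mul]
  split_ifs with h
  · rw [h, hj]; exact Submodule.subset_span ⟨L, hL, rfl⟩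
  · rw [zero_smul]; exact Submodule.zero_mem _

theorem v_mem_wordFilt (ha : StdLeg n m a) :
    𝐯 a ∈ wordFilt F e n κ₁ κ₂ m (∑ k, a k + 1) := by
  induction hs : ∑ k, a k using Nat.strong_induction_on generalizing a with
  | _ s ih =>
    by_cases h0 : a = initLeg m
    · rw [h0, v_initLeg]
      refine Submodule.subset_span ⟨[], ?_, by simp⟩
      rw [List.length_nil, ← hs, h0]
      omega
    obtain ⟨r, h1, h2, h3, h4⟩ := ha.exists_descent h0
    obtain ⟨b, hb, h5, h6, rfl, h7⟩ := ha.exists_legSwap h1 h2 h3 h4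
    rw [v_legSwap hb h5 h6, ← hs, h7]
    exact ψgen_smul_mem_wordFilt r (ih _ (by omega) hb rfl)

/-- If `r` and `r + 1` are both in the leg or both in the arm, then `ψ_r` lowers the length. -/
theorem ψgen_smul_v_mem_of_iff (ha : StdLeg n m a) (h1 : 1 ≤ r) (h2 : r + 1 ≤ n)
    (h : r ∈ Set.range a ↔ r + 1 ∈ Set.range a) :
    ψ r • 𝐯 a ∈ wordFilt F e n κ₁ κ₂ m (∑ k, a k) := by
  induction hs : ∑ k, a k using Nat.strong_induction_on generalizing a r with
  | _ S ih =>
    by_cases h0 : a = initLeg m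
    · have : r ≠ m := by
        rintro rfl
        rw [h0, mem_range_initLeg, mem_range_initLeg] at h
        omega
      rw [h0, v_initLeg, ψgen_smul_z this]
      exact Submodule.zero_mem _
    obtain ⟨s, hs1, hs2, h3, h4⟩ := ha.exists_descent h0
    obtain ⟨b, hb, h5, h6, rfl, h7⟩ := ha.exists_legSwap hs1 hs2 h3 h4
    rw [v_legSwap hb h5 h6]
    have hsr : s ≠ r := by rintro rfl; exact h3 (h.2 h4)
    by_cases hfar : s + 1 < r ∨ r + 1 < s
    · rw [smul_smul, ψgen_comm (by omega), mul_smul, ← hs, h7]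
      refine ψgen_smul_mem_wordFilt s (ih _ (by omega) hb h1 h2 ?_ rfl)
      rwa [mem_range_legSwap_of_ne (by omega) (by omega),
        mem_range_legSwap_of_ne (by omega) (by omega)] at h
    obtain rfl | rfl : s = r + 1 ∨ r = s + 1 := by omega
    · have hr : r ∉ Set.range b := by
        rw [← mem_range_legSwap_of_ne (r := r + 1) (by omega) (by omega)]
        exact fun hr => h3 (h.1 hr)
      obtain ⟨c, hc, h8, h9, rfl, h10⟩ := hb.exists_legSwap h1 h2 hr h5
      have h11 : r + 1 + 1 ∉ Set.range c := by
        rwa [mem_range_legSwap_of_ne (by omega) (by omega)] at h6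
      obtain ⟨α, hα⟩ := exists_ψgen_braid_smul (F := F)
        (eIdem_smul_v (F := F) (e := e) (κ₁ := κ₁) (κ₂ := κ₂) hc) h1 hs2
      rw [v_legSwap hc h8 h9, hα, ← hs, h7, h10]
      refine Submodule.add_mem _ ?_ (Submodule.smul_mem _ _
        (wordFilt_mono (by omega) (v_mem_wordFilt hc)))
      exact ψgen_smul_mem_wordFilt _ (ψgen_smul_mem_wordFilt _
        (ih _ (by omega) hc (by omega) hs2 (iff_of_false h9 h11) rfl))
    · have hr : s + 1 + 1 ∈ Set.range b := by
        rw [← mem_range_legSwap_of_ne (r := s) (by omega) (by omega)]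
        exact h.1 h4
      obtain ⟨c, hc, h8, h9, rfl, h10⟩ := hb.exists_legSwap h1 h2 h6 hr
      have h11 : s ∈ Set.range c := by
        rwa [mem_range_legSwap_of_ne (by omega) (by omega)] at h5
      obtain ⟨α, hα⟩ := exists_ψgen_braid_smul (F := F)
        (eIdem_smul_v (F := F) (e := e) (κ₁ := κ₁) (κ₂ := κ₂) hc) hs1 h2
      rw [v_legSwap hc h8 h9, ← sub_eq_of_eq_add hα, ← hs, h7, h10]
      refine Submodule.sub_mem _ ?_ (Submodule.smul_mem _ _
        (wordFilt_mono (by omega) (v_mem_wordFilt hc)))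
      exact ψgen_smul_mem_wordFilt _ (ψgen_smul_mem_wordFilt _
        (ih _ (by omega) hc hs1 (by omega) (iff_of_true h11 h8) rfl))

theorem wordFilt_le_span_v (hm : m ≤ n) (k : ℕ) :
    wordFilt F e n κ₁ κ₂ m k ≤
      Submodule.span F {x | ∃ a, StdLeg n m a ∧ ∑ j, a j < k ∧ x = 𝐯 a} := by
  induction k with
  | zero => exact Submodule.span_le.2 fun _ ⟨L, hL, _⟩ => absurd hL (Nat.not_lt_zero _)
  | succ k ih =>
    have hmono : Submodule.span F {x | ∃ a, StdLeg n m a ∧ ∑ j, a j < k ∧ x = 𝐯 a} ≤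
        Submodule.span F {x | ∃ a, StdLeg n m a ∧ ∑ j, a j < k + 1 ∧ x = 𝐯 a} :=
      Submodule.span_mono fun _ ⟨a, ha, hk, hx⟩ => ⟨a, ha, by omega, hx⟩
    refine Submodule.span_le.2 ?_
    rintro _ ⟨_ | ⟨r, L⟩, hL, rfl⟩
    · rw [List.map_nil, List.prod_nil, one_smul]
      exact Submodule.subset_span
        ⟨initLeg m, stdLeg_initLeg hm, by simpa using hL, v_initLeg.symm⟩
    rw [List.map_cons, List.prod_cons, mul_smul]
    rw [List.length_cons] at hL
    refine smul_mem_of_span ?_ (ih (Submodule.subset_span ⟨L, by omega, rfl⟩))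
    rintro _ ⟨a, ha, hk, rfl⟩
    by_cases hr : r = 0 ∨ n ≤ r
    · rw [ψgen_range hr, zero_smul]
      exact Submodule.zero_mem _
    have h1 : 1 ≤ r := by omega
    have h2 : r + 1 ≤ n := by omega
    by_cases h : r ∈ Set.range a ↔ r + 1 ∈ Set.range a
    · exact hmono (ih (wordFilt_mono hk.le (ψgen_smul_v_mem_of_iff ha h1 h2 h)))
    by_cases h3 : r ∈ Set.range a
    · have h4 : r + 1 ∉ Set.range a := fun h4 => h (iff_of_true h3 h4)
      refine Submodule.subset_span ⟨legSwap r a, ha.legSwap h1 h2 fun h5 => h4 h5.2, ?_,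
        (v_legSwap ha h3 h4).symm⟩
      rw [sum_legSwap ha h3 h4]
      omega
    · have h4 : r + 1 ∈ Set.range a := by_contra fun h4 => h (iff_of_false h3 h4)
      obtain ⟨b, hb, h5, h6, rfl, h7⟩ := ha.exists_legSwap h1 h2 h3 h4
      obtain ⟨α, β, h8⟩ := exists_ψgen_sq_smul (F := F)
        (eIdem_smul_v (F := F) (e := e) (κ₁ := κ₁) (κ₂ := κ₂) hb) h1 h2
      rw [v_legSwap hb h5 h6, h8]
      have hvb := v_mem_wordFilt (F := F) (e := e) (κ₁ := κ₁) (κ₂ := κ₂) hb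
      refine hmono (ih (Submodule.add_mem _ (Submodule.smul_mem _ _
        (wordFilt_mono (by omega) hvb)) (Submodule.smul_mem _ _ (Submodule.sub_mem _ ?_ ?_)))) <;>
      exact wordFilt_mono (by omega) (y_smul_mem_wordFilt _ hvb)

theorem exists_mem_wordFilt (x : Sp F e n κ₁ κ₂ m) : ∃ k, x ∈ wordFilt F e n κ₁ κ₂ m k := by
  suffices hU : ∀ (f : FreeH F e n) (x : Sp F e n κ₁ κ₂ m),
      (∃ k, x ∈ wordFilt F e n κ₁ κ₂ m k) →
      ∃ k, RingQuot.mkAlgHom F (Rel F e n κ₁ κ₂) f • x ∈ wordFilt F e n κ₁ κ₂ m k by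
    obtain ⟨h, rfl⟩ := Submodule.Quotient.mk_surjective _ x
    obtain ⟨f, rfl⟩ := RingQuot.mkAlgHom_surjective F (Rel F e n κ₁ κ₂) h
    have := hU f 𝐳 ⟨∑ j, initLeg m j + 1, Submodule.subset_span ⟨[], by simp, by simp⟩⟩
    rwa [z, ← Submodule.Quotient.mk_smul, smul_eq_mul, mul_one] at this
  intro f
  induction f using FreeAlgebra.induction with
  | grade0 c =>
    rintro x ⟨k, hk⟩
    refine ⟨k, ?_⟩
    rw [AlgHom.commutes, algebraMap_smul]
    exact Submodule.smul_mem _ _ hk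
  | grade1 g =>
    rintro x ⟨k, hk⟩
    cases g with
    | E i => exact ⟨k, eIdem_smul_mem_wordFilt i hk⟩
    | Y r => exact ⟨k, y_smul_mem_wordFilt r (wordFilt_mono k.le_succ hk)⟩
    | Psi r => exact ⟨k + 1, ψgen_smul_mem_wordFilt r hk⟩
  | mul f g hf hg =>
    intro x hx
    rw [map_mul, mul_smul]
    exact hf _ (hg x hx)
  | add f g hf hg =>
    intro x hx
    obtain ⟨k, hk⟩ := hf x hx
    obtain ⟨l, hl⟩ := hg x hx
    refine ⟨max k l, ?_⟩
    rw [map_add, add_smul]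
    exact Submodule.add_mem _ (wordFilt_mono (le_max_left _ _) hk)
      (wordFilt_mono (le_max_right _ _) hl)

/-- The weight space for `i` is spanned by the `v(a)` whose tableau has residue sequence `i`. -/
theorem eIdem_smul_mem_span (hm : m ≤ n) (i : Fin n → ZMod e) (x : Sp F e n κ₁ κ₂ m) :
    𝐞 i • x ∈ Submodule.span F (𝐯 '' {a | StdLeg n m a ∧ legRes e n κ₁ κ₂ a = i}) := by
  obtain ⟨k, hk⟩ := exists_mem_wordFilt x
  refine smul_mem_of_span ?_ (wordFilt_le_span_v hm k hk)
  rintro _ ⟨a, ha, -, rfl⟩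
  rw [← eIdem_smul_v ha, smul_smul, eIdem_mul]
  split_ifs with h
  · rw [h, eIdem_smul_v ha]
    exact Submodule.subset_span ⟨a, ⟨ha, rfl⟩, rfl⟩
  · rw [zero_smul]; exact Submodule.zero_mem _

theorem ψgen_smul_v_eq_zero (he : 3 ≤ e) (ha : StdLeg n m a) (h1 : 1 ≤ r) (h2 : r + 1 ≤ n)
    (hres : resAt e κ₁ κ₂ a (r + 1) = resAt e κ₁ κ₂ a r) (h : r ∉ Set.range a) :
    ψ r • 𝐯 a = 0 := by
  have h' := (mem_iff_notMem_of_resAt_eq he ha hres).2 h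
  obtain ⟨b, hb, h5, h6, rfl, -⟩ := ha.exists_legSwap h1 h2 h h'
  rw [v_legSwap hb h5 h6]
  refine ψgen_sq_smul_eq_zero (eIdem_smul_v hb) h1 h2 ?_
  rw [← ent_legRes (n := n) (by omega) h2, ← ent_legRes (n := n) h1 (by omega),
    ← swapIdx_legRes hb h1 h2 h5 h6] at hres
  have h3 : ent e n (swapIdx e n r (legRes e n κ₁ κ₂ b)) (r + 1) =
      ent e n (legRes e n κ₁ κ₂ b) r := by
    rw [ent, dif_pos ⟨by omega, h2⟩, swapIdx]
    simp
  have h4 : ent e n (swapIdx e n r (legRes e n κ₁ κ₂ b)) r =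
      ent e n (legRes e n κ₁ κ₂ b) (r + 1) := by
    rw [ent, dif_pos ⟨h1, by omega⟩, swapIdx]
    simp [Nat.sub_add_cancel h1]
  rw [← h3, ← h4, hres]

/-- A submodule containing a formally nonzero combination of `v(a)`s of one weight contains some
`v(a)`. -/
theorem exists_v_mem_of_sum_mem (he : 3 ≤ e) (N : Submodule (H F e n κ₁ κ₂) (Sp F e n κ₁ κ₂ m))
    (T : Finset (Fin m → ℕ)) (c : (Fin m → ℕ) → F) (i : Fin n → ZMod e)
    (hT : ∀ a ∈ T, StdLeg n m a ∧ legRes e n κ₁ κ₂ a = i) (hc : ∀ a ∈ T, c a ≠ 0)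
    (hne : T.Nonempty) (hN : ∑ a ∈ T, c a • 𝐯 a ∈ N) : ∃ a, StdLeg n m a ∧ 𝐯 a ∈ N := by
  classical
  induction hs : T.card using Nat.strong_induction_on generalizing T c i with
  | _ s ih =>
    by_cases h1 : ∃ a, T = {a}
    · obtain ⟨a, rfl⟩ := h1
      have ha := Finset.mem_singleton_self a
      refine ⟨a, (hT a ha).1, ?_⟩
      rw [Finset.sum_singleton] at hN
      have h := N.smul_of_tower_mem (c a)⁻¹ hN
      have h' : (c a)⁻¹ • c a • 𝐯 a = 𝐯 a := inv_smul_smul₀ (hc a ha) (𝐯 a)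
      rwa [h'] at h
    have h2 : T.Nontrivial := by
      rcases hne.exists_eq_singleton_or_nontrivial with h | h
      · exact absurd h h1
      · exact h
    obtain ⟨a, ha, b, hb, hab⟩ := h2
    obtain ⟨r, hr1, hr2, hres, hdiff⟩ := exists_resAt_eq he (hT a ha).1 (hT b hb).1
      ((hT a ha).2.trans (hT b hb).2.symm) hab
    have hres' : ∀ d ∈ T, resAt e κ₁ κ₂ d (r + 1) = resAt e κ₁ κ₂ d r := fun d hd => by
      rw [← ent_legRes (n := n) (by omega) hr2, ← ent_legRes (n := n) hr1 (by omega)] at hres ⊢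
      rwa [(hT d hd).2, ← (hT a ha).2]
    have hmem : ∀ d ∈ T, r + 1 ∈ Set.range d ↔ r ∉ Set.range d := fun d hd =>
      mem_iff_notMem_of_resAt_eq he (hT d hd).1 (hres' d hd)
    have hsum : ψ r • ∑ d ∈ T, c d • 𝐯 d =
        ∑ d ∈ (T.filter (r ∈ Set.range ·)).image (legSwap r), c (legSwap r d) • 𝐯 d := by
      rw [Finset.sum_image fun _ _ _ _ h => legSwap_injective r h, Finset.smul_sum,
        Finset.sum_filter]
      refine Finset.sum_congr rfl fun d hd => ?_
      rw [smul_comm, legSwap_legSwap]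
      split_ifs with h
      · rw [v_legSwap (hT d hd).1 h fun h' => (hmem d hd).1 h' h]
      · rw [ψgen_smul_v_eq_zero he (hT d hd).1 hr1 hr2 (hres' d hd) h]
        exact smul_zero (A := Sp F e n κ₁ κ₂ m) (c d)
    refine ih _ ?_ _ (fun d => c (legSwap r d)) (swapIdx e n r i) ?_ ?_ ?_
      (hsum ▸ N.smul_mem _ hN) rfl
    · rw [← hs, Finset.card_image_of_injective _ (legSwap_injective r)]
      refine Finset.card_lt_card (Finset.filter_ssubset.2 ?_)
      by_cases h : r ∈ Set.range a
      · exact ⟨b, hb, fun h' => hdiff (iff_of_true h h')⟩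
      · exact ⟨a, ha, h⟩
    · simp only [Finset.mem_image, Finset.mem_filter]
      rintro _ ⟨d, ⟨hd, h⟩, rfl⟩
      have h' : r + 1 ∉ Set.range d := fun h' => (hmem d hd).1 h' h
      refine ⟨(hT d hd).1.legSwap hr1 hr2 fun h3 => h' h3.2, ?_⟩
      rw [← swapIdx_legRes (hT d hd).1 hr1 hr2 h h', (hT d hd).2]
    · simp only [Finset.mem_image, Finset.mem_filter]
      rintro _ ⟨d, ⟨hd, -⟩, rfl⟩
      rw [legSwap_legSwap]
      exact hc d hd
    · refine Finset.Nonempty.image ?_ _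
      by_cases h : r ∈ Set.range a
      · exact ⟨a, Finset.mem_filter.2 ⟨ha, h⟩⟩
      · refine ⟨b, Finset.mem_filter.2 ⟨hb, ?_⟩⟩
        exact by_contra fun h' => hdiff (iff_of_false h h')

end Specht

/-- Lemma 6.8 of the paper: every nonzero `H`-submodule of
`S_{((n-m),(1^m))}` contains a standard basis vector `v(a₁,…,a_m)`. -/
theorem statement13 (F : Type*) [Field F] (e n : ℕ) [NeZero e] (he : 3 ≤ e) (hn : 1 ≤ n)
    (κ₁ κ₂ : ZMod e) (m : ℕ) (hm : m ≤ n) :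
    ∀ N : Submodule (H F e n κ₁ κ₂) (Sp F e n κ₁ κ₂ m), N ≠ ⊥ →
      ∃ a : Fin m → ℕ, StdLeg n m a ∧ v F e n κ₁ κ₂ m a ∈ N := by
  intro N hN
  obtain ⟨x, hx, hx0⟩ := N.ne_bot_iff.1 hN
  obtain ⟨i, hi⟩ : ∃ i, eIdem F e n κ₁ κ₂ i • x ≠ 0 := by
    by_contra! h
    apply hx0
    rw [← one_smul (H F e n κ₁ κ₂) x, ← sum_eIdem, Finset.sum_smul]
    exact Finset.sum_eq_zero fun i _ => h i
  obtain ⟨l, hl, hlx⟩ := (Finsupp.mem_span_image_iff_linearCombination F).1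
    (eIdem_smul_mem_span hm i x)
  refine exists_v_mem_of_sum_mem he N l.support l i (fun a ha => hl ha)
    (fun a ha => Finsupp.mem_support_iff.1 ha) ?_ ?_
  · rw [Finset.nonempty_iff_ne_empty, Ne, Finsupp.support_eq_empty]
    rintro rfl
    rw [map_zero] at hlx
    exact hi hlx.symm
  · rw [Finsupp.linearCombination_apply, Finsupp.sum] at hlx
    rw [hlx]
    exact N.smul_mem _ hx

end KLRHook
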